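/- For every parameter m ∈ [0,1/2] and every x ∈ (0, 2K(m)), the strict inequality 4·dn²(x|m)·(1 + cn(x|m)) − sn²(x|m)·(1 − cn(x|m)) > 0 holds. -/

import Mathlib

noncomputable section

open Complex Filter Set Asymptotics

/-- Complete elliptic integral of the first kind with complex parameter `m`,
using the principal branch of the square root. -/
def ellK (m : ℂ) : ℂ :=
  ∫ t in (0:ℝ)..1, 1 / ((1 - (t : ℂ) ^ 2) * (1 - m * (t : ℂ) ^ 2)) ^ ((1 : ℂ) / 2)

/-- The nome `q = exp (-π K(1-m)/K(m))`. -/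
def nome (m : ℂ) : ℂ := Complex.exp (-(Real.pi : ℂ) * ellK (1 - m) / ellK m)

/-- Jacobi theta function θ₁(z, q). -/
def theta1 (z q : ℂ) : ℂ :=
  2 * ∑' n : ℕ, (-1 : ℂ) ^ n * q ^ (((n : ℂ) + 1 / 2) ^ 2) *
    Complex.sin ((2 * (n : ℂ) + 1) * z)

/-- Jacobi theta function θ₂(z, q). -/
def theta2 (z q : ℂ) : ℂ :=
  2 * ∑' n : ℕ, q ^ (((n : ℂ) + 1 / 2) ^ 2) * Complex.cos ((2 * (n : ℂ) + 1) * z)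

/-- Jacobi theta function θ₃(z, q). -/
def theta3 (z q : ℂ) : ℂ :=
  1 + 2 * ∑' n : ℕ, q ^ ((n + 1) ^ 2) * Complex.cos (2 * ((n : ℂ) + 1) * z)

/-- Jacobi theta function θ₄(z, q). -/
def theta4 (z q : ℂ) : ℂ :=
  1 + 2 * ∑' n : ℕ, (-1 : ℂ) ^ (n + 1) * q ^ ((n + 1) ^ 2) *
    Complex.cos (2 * ((n : ℂ) + 1) * z)

/-- Jacobian elliptic function sn(z | m) with complex argument and parameter,
defined through quotients of Jacobi theta functions with nome
`q = exp (-π K(1-m)/K(m))` (so that `sn (K m * u) m` corresponds to the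
theta quotient at `π u / 2`). -/
def sn (z m : ℂ) : ℂ :=
  (theta3 0 (nome m) / theta2 0 (nome m)) *
    (theta1 ((Real.pi : ℂ) * z / (2 * ellK m)) (nome m) /
      theta4 ((Real.pi : ℂ) * z / (2 * ellK m)) (nome m))

/-- Jacobian elliptic function cn(z | m). -/
def cn (z m : ℂ) : ℂ :=
  (theta4 0 (nome m) / theta2 0 (nome m)) *
    (theta2 ((Real.pi : ℂ) * z / (2 * ellK m)) (nome m) /
      theta4 ((Real.pi : ℂ) * z / (2 * ellK m)) (nome m))

/-- Jacobian elliptic function dn(z | m). -/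
def dn (z m : ℂ) : ℂ :=
  (theta4 0 (nome m) / theta3 0 (nome m)) *
    (theta3 ((Real.pi : ℂ) * z / (2 * ellK m)) (nome m) /
      theta4 ((Real.pi : ℂ) * z / (2 * ellK m)) (nome m))

/-- The lattice ratio τ = i K(1-m)/K(m). -/
def tauC (m : ℂ) : ℂ := Complex.I * ellK (1 - m) / ellK m

/-- Subsidiary Jacobian elliptic function sc = sn/cn. -/
def sc (z m : ℂ) : ℂ := sn z m / cn z m

/-- Subsidiary Jacobian elliptic function nc = 1/cn. -/
def nc (z m : ℂ) : ℂ := 1 / cn z m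

/-- Subsidiary Jacobian elliptic function dc = dn/cn. -/
def dcC (z m : ℂ) : ℂ := dn z m / cn z m

/-- The branch cut [1, ∞) on the real axis. -/
def cut : Set ℂ := {z : ℂ | z.im = 0 ∧ 1 ≤ z.re}

/-- Real complete elliptic integral of the first kind (for real parameter `m < 1`
the complex integral is real-valued). -/
def KR (m : ℝ) : ℝ := (ellK (m : ℂ)).re

/-- Classical real Jacobian elliptic function sn(x | m). -/
def snR (x m : ℝ) : ℝ := (sn (x : ℂ) (m : ℂ)).re

/-- Classical real Jacobian elliptic function cn(x | m). -/
def cnR (x m : ℝ) : ℝ := (cn (x : ℂ) (m : ℂ)).re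

/-- Classical real Jacobian elliptic function dn(x | m). -/
def dnR (x m : ℝ) : ℝ := (dn (x : ℂ) (m : ℂ)).re

/-- φ(u, μ) = dc²(K(1-μ)u | 1-μ) − dc²(K(μ)u | μ) with real dc = dn/cn. -/
def phi (u μ : ℝ) : ℝ :=
  (dnR (KR (1 - μ) * u) (1 - μ) / cnR (KR (1 - μ) * u) (1 - μ)) ^ 2 -
    (dnR (KR μ * u) μ / cnR (KR μ * u) μ) ^ 2

/-- The square of the continuously extended modulus |sn(K(m)u | m)|² for `m > 1`,
given by μ(s²d₁² + c²d²s₁²c₁²)/(1 − d²s₁²)² with μ = 1/m, μ₁ = 1 − μ. -/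
def snAbsSq (u m : ℝ) : ℝ :=
  let μ := 1 / m
  let μ₁ := 1 - μ
  let s := snR (KR μ * u) μ
  let c := cnR (KR μ * u) μ
  let d := dnR (KR μ * u) μ
  let s₁ := snR (KR μ₁ * u) μ₁
  let c₁ := cnR (KR μ₁ * u) μ₁
  let d₁ := dnR (KR μ₁ * u) μ₁
  μ * (s ^ 2 * d₁ ^ 2 + c ^ 2 * d ^ 2 * s₁ ^ 2 * c₁ ^ 2) / (1 - d ^ 2 * s₁ ^ 2) ^ 2

def T2 (t z : ℝ) : ℝ := 2 * ∑' n : ℕ, Real.exp (-Real.pi * ((n:ℝ) + 1/2)^2 * t) * Real.cos ((2 * (n:ℝ) + 1) * z)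

def T3 (t z : ℝ) : ℝ := 1 + 2 * ∑' n : ℕ, Real.exp (-Real.pi * ((n:ℝ) + 1)^2 * t) * Real.cos (2 * ((n:ℝ) + 1) * z)

/-- bilateral theta term -/
def Fterm (t α z : ℝ) (n : ℤ) : ℂ :=
  (Real.exp (-Real.pi * ((n:ℝ) + α)^2 * t) : ℝ) * Complex.exp (2 * Complex.I * ((n:ℂ) + α) * z)

def FF (t α z : ℝ) : ℂ := ∑' n : ℤ, Fterm t α z n

lemma Fterm_norm (t α z : ℝ) (n : ℤ) : ‖Fterm t α z n‖ = Real.exp (-Real.pi * ((n:ℝ) + α)^2 * t) := by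
  unfold Fterm
  have : (2 * Complex.I * ((n:ℂ) + α) * z) = ((2 * ((n:ℝ) + α) * z : ℝ) : ℂ) * Complex.I := by
    push_cast; ring
  rw [norm_mul, this, Complex.norm_exp_ofReal_mul_I, mul_one, Complex.norm_real, Real.norm_eq_abs,
    abs_of_pos (Real.exp_pos _)]

lemma Fterm_summable_norm {t : ℝ} (ht : 0 < t) (α z : ℝ) : Summable (fun n => ‖Fterm t α z n‖) := by
  simp_rw [Fterm_norm]
  exact (HurwitzZeta.hasSum_int_evenKernel α ht).summable

lemma Fterm_hasSum {t : ℝ} (ht : 0 < t) (α z : ℝ) : HasSum (Fterm t α z) (FF t α z) :=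
  (Fterm_summable_norm ht α z).of_norm.hasSum

lemma FF_add_one {t : ℝ} (α z : ℝ) : FF t (α + 1) z = FF t α z := by
  unfold FF
  rw [← (Equiv.addRight (1:ℤ)).tsum_eq (Fterm t α z)]
  congr 1; ext n
  simp only [Fterm, Equiv.coe_addRight]
  push_cast
  ring_nf

lemma FF_dup {t : ℝ} (ht : 0 < t) (α z : ℝ) :
    FF t α z ^ 2 = FF (2*t) α (2*z) * FF (2*t) 0 0 + FF (2*t) (α + 1/2) (2*z) * FF (2*t) (1/2) 0 := by
  have ht2 : 0 < 2 * t := by linarith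
  have hprod : HasSum (fun p : ℤ × ℤ => Fterm t α z p.1 * Fterm t α z p.2) (FF t α z ^ 2) := by
    rw [sq]
    exact (Fterm_hasSum ht α z).mul (Fterm_hasSum ht α z)
      (summable_mul_of_summable_norm (Fterm_summable_norm ht α z) (Fterm_summable_norm ht α z))
  have hA : HasSum (fun p : ℤ × ℤ => Fterm (2*t) α (2*z) p.1 * Fterm (2*t) 0 0 p.2)
      (FF (2*t) α (2*z) * FF (2*t) 0 0) :=
    (Fterm_hasSum ht2 _ _).mul (Fterm_hasSum ht2 _ _)
      (summable_mul_of_summable_norm (Fterm_summable_norm ht2 _ _) (Fterm_summable_norm ht2 _ _))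
  have hB : HasSum (fun p : ℤ × ℤ => Fterm (2*t) (α+1/2) (2*z) p.1 * Fterm (2*t) (1/2) 0 p.2)
      (FF (2*t) (α+1/2) (2*z) * FF (2*t) (1/2) 0) :=
    (Fterm_hasSum ht2 _ _).mul (Fterm_hasSum ht2 _ _)
      (summable_mul_of_summable_norm (Fterm_summable_norm ht2 _ _) (Fterm_summable_norm ht2 _ _))
  let g : ℤ × ℤ → ℂ := fun p => Fterm t α z p.1 * Fterm t α z p.2
  let i1 : ℤ × ℤ → ℤ × ℤ := fun p => (p.1 + p.2, p.1 - p.2)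
  let i2 : ℤ × ℤ → ℤ × ℤ := fun p => (p.1 + p.2 + 1, p.1 - p.2)
  have hi1 : Function.Injective i1 := by
    rintro ⟨a, b⟩ ⟨c, d⟩ h
    simp only [i1, Prod.mk.injEq] at h ⊢
    omega
  have hi2 : Function.Injective i2 := by
    rintro ⟨a, b⟩ ⟨c, d⟩ h
    simp only [i2, Prod.mk.injEq] at h ⊢
    omega
  have hA' : HasSum (g ∘ i1) (FF (2*t) α (2*z) * FF (2*t) 0 0) := by
    convert hA using 1
    ext ⟨j, k⟩
    simp only [g, i1, Function.comp, Fterm]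
    rw [mul_mul_mul_comm, mul_mul_mul_comm (Complex.ofReal (Real.exp (_ * _ * (2*t)))), ← Complex.ofReal_mul, ← Complex.ofReal_mul,
      ← Real.exp_add, ← Real.exp_add, ← Complex.exp_add, ← Complex.exp_add]
    congr 1
    · congr 2; push_cast; ring
    · congr 1; push_cast; ring
  have hB' : HasSum (g ∘ i2) (FF (2*t) (α+1/2) (2*z) * FF (2*t) (1/2) 0) := by
    convert hB using 1
    ext ⟨j, k⟩
    simp only [g, i2, Function.comp, Fterm]
    rw [mul_mul_mul_comm, mul_mul_mul_comm (Complex.ofReal (Real.exp (_ * _ * (2*t)))), ← Complex.ofReal_mul, ← Complex.ofReal_mul,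
      ← Real.exp_add, ← Real.exp_add, ← Complex.exp_add, ← Complex.exp_add]
    congr 1
    · congr 2; push_cast; ring
    · congr 1; push_cast; ring
  have hc : IsCompl (Set.range i1) (Set.range i2) := by
    rw [isCompl_iff, codisjoint_iff]
    constructor
    · rw [Set.disjoint_left]
      rintro _ ⟨⟨a, b⟩, rfl⟩ ⟨⟨c, d⟩, h⟩
      simp only [i1, i2, Prod.mk.injEq] at h
      omega
    · change Set.range i1 ∪ Set.range i2 = Set.univ
      ext ⟨m, n⟩
      simp only [Set.mem_union, Set.mem_range, Set.mem_univ, iff_true, i1, i2, Prod.mk.injEq, Prod.exists]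
      rcases Int.even_or_odd' (m + n) with ⟨k, hk | hk⟩
      · left; exact ⟨k, m - k, by omega, by omega⟩
      · right; exact ⟨k, m - k - 1, by omega, by omega⟩
  exact hprod.unique ((hi1.hasSum_range_iff.2 hA').add_isCompl hc (hi2.hasSum_range_iff.2 hB'))

lemma FF_half {t : ℝ} (ht : 0 < t) (z : ℝ) : FF t (1/2) z = (T2 t z : ℂ) := by
  have h := (Fterm_hasSum ht (1/2) z).nat_add_neg_add_one
  rw [← h.tsum_eq, T2]
  push_cast
  rw [← tsum_mul_left]
  congr 1; ext n
  simp only [Fterm]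
  have e1 : -Real.pi * (((-((n:ℤ)+1) : ℤ) : ℝ) + 1/2)^2 * t = -Real.pi * (((n:ℤ):ℝ) + 1/2)^2 * t := by
    push_cast; ring
  rw [e1, Complex.cos]
  push_cast
  rw [show 2 * Complex.I * ((n:ℂ) + 1/2) * z = (2 * (n:ℂ) + 1) * z * Complex.I by ring,
    show 2 * Complex.I * (-((n:ℂ)+1) + 1/2) * z = -((2 * (n:ℂ) + 1) * z) * Complex.I by ring]
  ring

lemma FF_zero {t : ℝ} (ht : 0 < t) (z : ℝ) : FF t 0 z = (T3 t z : ℂ) := by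
  have h := (Fterm_hasSum ht 0 z).nat_add_neg
  rw [← hasSum_nat_add_iff' 1] at h
  have h2 := h.tsum_eq
  have h0 : Fterm t 0 z 0 = 1 := by simp [Fterm]
  simp only [Finset.sum_range_one, Nat.cast_zero, neg_zero, h0] at h2
  rw [T3]
  push_cast
  rw [← tsum_mul_left]
  have : FF t 0 z = 1 + (FF t 0 z + 1 - (1 + 1)) := by ring
  rw [this, ← h2]
  congr 2; ext n
  simp only [Fterm]
  have e1 : -Real.pi * (((-((n+1 : ℕ):ℤ) : ℤ) : ℝ) + 0)^2 * t = -Real.pi * ((n:ℝ) + 1)^2 * t := by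
    push_cast; ring
  have e2 : -Real.pi * (((((n+1 : ℕ):ℤ) : ℤ) : ℝ) + 0)^2 * t = -Real.pi * ((n:ℝ) + 1)^2 * t := by
    push_cast; ring
  rw [e1, e2, Complex.cos]
  push_cast
  rw [show 2 * Complex.I * ((n:ℂ) + 1 + 0) * z = (2 * ((n:ℂ) + 1)) * z * Complex.I by ring,
    show 2 * Complex.I * (-((n:ℂ)+1) + 0) * z = -((2 * ((n:ℂ) + 1)) * z) * Complex.I by ring]
  ring

lemma T3_sq {t : ℝ} (ht : 0 < t) (z : ℝ) :
    T3 t z ^ 2 = T3 (2*t) (2*z) * T3 (2*t) 0 + T2 (2*t) (2*z) * T2 (2*t) 0 := by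
  have ht2 : 0 < 2 * t := by linarith
  have h := FF_dup ht 0 z
  rw [zero_add, FF_zero ht, FF_zero ht2, FF_zero ht2, FF_half ht2, FF_half ht2] at h
  exact_mod_cast h

lemma T2_sq {t : ℝ} (ht : 0 < t) (z : ℝ) :
    T2 t z ^ 2 = T2 (2*t) (2*z) * T3 (2*t) 0 + T3 (2*t) (2*z) * T2 (2*t) 0 := by
  have ht2 : 0 < 2 * t := by linarith
  have h := FF_dup ht (1/2) z
  rw [show (1/2:ℝ) + 1/2 = 0 + 1 by norm_num, FF_add_one, FF_half ht, FF_zero ht2, FF_zero ht2,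
    FF_half ht2, FF_half ht2] at h
  exact_mod_cast h

lemma T2_shift (t z : ℝ) : T2 t (z - Real.pi) = - T2 t z := by
  unfold T2
  rw [← mul_neg, ← tsum_neg]
  congr 2; ext n
  rw [show (2 * (n:ℝ) + 1) * (z - Real.pi) = (2 * (n:ℝ) + 1) * z - Real.pi - n * (2 * Real.pi) by ring,
    Real.cos_sub_nat_mul_two_pi, Real.cos_sub_pi]
  ring

lemma T3_shift (t z : ℝ) : T3 t (z - Real.pi) = T3 t z := by
  unfold T3
  congr 3; ext n
  rw [show 2 * ((n:ℝ) + 1) * (z - Real.pi) = 2 * ((n:ℝ) + 1) * z - ((n+1 : ℕ):ℝ) * (2 * Real.pi) by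
    push_cast; ring,
    Real.cos_sub_nat_mul_two_pi]

lemma exp_int (t : ℝ) (n : ℕ) : Real.exp (-Real.pi * ((n:ℝ) + 1)^2 * t) = Real.exp (-Real.pi * t) ^ ((n+1)^2) := by
  rw [← Real.exp_nat_mul]; congr 1; push_cast; ring

lemma q_le {t : ℝ} (ht : 1 ≤ t) : Real.exp (-Real.pi * t) ≤ 1 / 16 := by
  have h1 : Real.exp (-Real.pi * t) ≤ Real.exp (-3) := by
    apply Real.exp_le_exp.2
    nlinarith [Real.pi_gt_three]
  refine h1.trans ?_
  rw [Real.exp_neg, one_div]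
  apply inv_anti₀ (by norm_num)
  have := Real.exp_one_gt_d9
  have e : Real.exp 3 = Real.exp 1 ^ 3 := by rw [← Real.exp_nat_mul]; norm_num
  rw [e]
  have : (2.7:ℝ)^3 ≤ Real.exp 1 ^ 3 := by gcongr; linarith
  norm_num at this ⊢; linarith

lemma q_pow_le {q : ℝ} (h0 : 0 ≤ q) (h1 : q ≤ 1/16) (n : ℕ) : q ^ ((n+1)^2) ≤ 1/16 * (1/16)^n := by
  calc q ^ ((n+1)^2) ≤ q ^ (n+1) := pow_le_pow_of_le_one h0 (by linarith) (by nlinarith)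
    _ ≤ (1/16)^(n+1) := by gcongr
    _ = _ := by ring

lemma geo16 : HasSum (fun n : ℕ => (1/16:ℝ) * (1/16)^n) (1/15) := by
  have := (hasSum_geometric_of_lt_one (r := (1/16:ℝ)) (by norm_num) (by norm_num)).mul_left (1/16)
  norm_num at this ⊢
  exact this

lemma T3_pos {t : ℝ} (ht : 1 ≤ t) (z : ℝ) : 0 < T3 t z := by
  unfold T3
  have hb : ∀ n : ℕ, ‖Real.exp (-Real.pi * ((n:ℝ) + 1)^2 * t) * Real.cos (2 * ((n:ℝ) + 1) * z)‖
      ≤ 1/16 * (1/16)^n := by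
    intro n
    rw [norm_mul, exp_int]
    have h1 : ‖Real.exp (-Real.pi * t) ^ ((n+1)^2)‖ ≤ 1/16 * (1/16)^n := by
      rw [Real.norm_of_nonneg (by positivity)]
      exact q_pow_le (Real.exp_pos _).le (q_le ht) n
    have h2 := Real.abs_cos_le_one (2 * ((n:ℝ) + 1) * z)
    calc _ ≤ (1/16 * (1/16)^n : ℝ) * 1 := by
            apply mul_le_mul h1 h2 (abs_nonneg _) (by positivity)
      _ = _ := mul_one _
  have := tsum_of_norm_bounded geo16 hb
  rw [Real.norm_eq_abs, abs_le] at this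
  linarith [this.1]

lemma T2_summable {t : ℝ} (ht : 0 < t) : Summable (fun n : ℕ => Real.exp (-Real.pi * ((n:ℝ) + 1/2)^2 * t)) := by
  have := (HurwitzZeta.hasSum_int_evenKernel (1/2) ht).summable.comp_injective Nat.cast_injective (α := ℝ)
  simpa [Function.comp_def] using this

lemma T3_summable {t : ℝ} (ht : 0 < t) : Summable (fun n : ℕ => Real.exp (-Real.pi * ((n:ℝ) + 1)^2 * t)) := by
  have := (HurwitzZeta.hasSum_int_evenKernel 1 ht).summable.comp_injective Nat.cast_injective (α := ℝ)
  simpa [Function.comp_def] using this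

lemma T2_pos {t : ℝ} (ht : 0 < t) : 0 < T2 t 0 := by
  unfold T2
  have := (T2_summable ht).tsum_pos (fun n => (Real.exp_pos _).le) 0 (Real.exp_pos _)
  simpa using this

lemma T2_anti {s t : ℝ} (hs : 0 < s) (hst : s ≤ t) : T2 t 0 ≤ T2 s 0 := by
  unfold T2
  simp only [mul_zero, Real.cos_zero, mul_one]
  have := (T2_summable (hs.trans_le hst)).tsum_le_tsum (g := fun n : ℕ => Real.exp (-Real.pi * ((n:ℝ) + 1/2)^2 * s))
    (fun n => by
      apply Real.exp_le_exp.2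
      have : 0 ≤ Real.pi * ((n:ℝ)+1/2)^2 := by positivity
      nlinarith) (T2_summable hs)
  linarith

lemma cos_alt (n : ℕ) (z : ℝ) : Real.cos (2 * ((n:ℝ) + 1) * (z + Real.pi/2)) = (-1)^(n+1) * Real.cos (2 * ((n:ℝ) + 1) * z) := by
  rw [show 2 * ((n:ℝ) + 1) * (z + Real.pi/2) = 2 * ((n:ℝ) + 1) * z + ((n+1 : ℕ):ℝ) * Real.pi by push_cast; ring,
    Real.cos_add_nat_mul_pi]

lemma pow_diff_anti {p q : ℝ} (hp : 0 ≤ p) (hpq : p ≤ q) (hq : q ≤ 1/16) : Antitone (fun k : ℕ => q^(k+1) - p^(k+1)) := by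
  apply antitone_nat_of_succ_le
  intro k
  have h1 : p^k ≤ q^k := by gcongr
  have h2 : p * (1-p) ≤ q * (1-q) := by nlinarith
  have : p^k * (p * (1-p)) ≤ q^k * (q * (1-q)) := by
    apply mul_le_mul h1 h2 (by apply mul_nonneg hp; linarith) (pow_nonneg (hp.trans hpq) k)
  simp only [pow_succ]
  nlinarith

lemma T4_mono {t : ℝ} (ht : 1 ≤ t) : T3 1 (Real.pi/2) ≤ T3 t (Real.pi/2) := by
  have key : ∀ s : ℝ, T3 s (Real.pi/2) = 1 - 2 * ∑' n : ℕ, (-1:ℝ)^n * Real.exp (-Real.pi * s) ^ ((n+1)^2) := by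
    intro s
    unfold T3
    rw [sub_eq_add_neg, ← mul_neg, ← tsum_neg]
    congr 3; ext n
    have := cos_alt n 0
    rw [zero_add] at this
    rw [this, exp_int, mul_zero, Real.cos_zero]
    ring
  rw [key, key]
  have S : ∀ s : ℝ, 0 < s → Summable (fun n : ℕ => Real.exp (-Real.pi * s) ^ ((n+1)^2)) := by
    intro s hs
    simpa only [exp_int] using T3_summable hs
  have S' : ∀ s : ℝ, 0 < s → Summable (fun n : ℕ => (-1:ℝ)^n * Real.exp (-Real.pi * s) ^ ((n+1)^2)) := by
    intro s hs
    refine Summable.of_norm ?_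
    simpa [norm_mul, abs_of_pos (Real.exp_pos _)] using S s hs
  have hpq : Real.exp (-Real.pi * t) ≤ Real.exp (-Real.pi * 1) := by
    apply Real.exp_le_exp.2; nlinarith [Real.pi_pos]
  have ha := pow_diff_anti (Real.exp_pos _).le hpq (q_le le_rfl)
  have hb : Antitone (fun n : ℕ => Real.exp (-Real.pi * 1) ^ ((n+1)^2) - Real.exp (-Real.pi * t) ^ ((n+1)^2)) := by
    have hm : Monotone (fun n : ℕ => n^2 + 2*n) := by
      intro a b h; dsimp; gcongr
    have := ha.comp_monotone hm
    convert this using 2 with n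
    simp only [Function.comp]
    congr 2 <;> ring
  have hs1 := S' 1 one_pos
  have hst := S' t (by linarith)
  have hfin := hb.alternating_series_le_tendsto (l := ∑' n : ℕ, (-1:ℝ)^n * (Real.exp (-Real.pi * 1) ^ ((n+1)^2) - Real.exp (-Real.pi * t) ^ ((n+1)^2)))
    (by
      apply HasSum.tendsto_sum_nat
      apply Summable.hasSum
      simpa only [mul_sub] using hs1.sub hst) 0
  simp only [mul_sub, mul_zero, Finset.range_zero, Finset.sum_empty] at hfin
  rw [hs1.tsum_sub hst] at hfin
  linarith

lemma T2_eq_T4 : T2 1 0 = T3 1 (Real.pi/2) := by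
  have h := HurwitzZeta.evenKernel_functional_equation ((1/2 : ℝ) : UnitAddCircle) 1
  rw [Real.one_rpow, div_one, one_mul] at h
  have h1 : T2 1 0 = HurwitzZeta.evenKernel ((1/2 : ℝ) : UnitAddCircle) 1 := by
    rw [← (HurwitzZeta.hasSum_int_evenKernel (1/2) one_pos).nat_add_neg_add_one.tsum_eq]
    unfold T2
    rw [← tsum_mul_left]
    congr 1; ext n
    rw [mul_zero, Real.cos_zero, mul_one, two_mul]
    congr 2
    push_cast; ring
  have h2 := (HurwitzZeta.hasSum_nat_cosKernel₀ (1/2) one_pos).tsum_eq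
  rw [h1, h]
  unfold T3
  rw [← tsum_mul_left]
  have : ∀ x : ℝ, x = 1 + (x - 1) := fun x => by ring
  rw [this (HurwitzZeta.cosKernel _ _), ← h2]
  congr 2; ext n
  rw [show 2 * Real.pi * (1/2) * ((n:ℝ)+1) = 2 * ((n:ℝ) + 1) * (Real.pi / 2) by ring]
  ring

lemma T2_le_T4 {t : ℝ} (ht : 1 ≤ t) : T2 t 0 ≤ T3 t (Real.pi/2) :=
  (T2_anti one_pos ht).trans (T2_eq_T4.le.trans (T4_mono ht))

lemma abs_sin_odd (z : ℝ) (n : ℕ) : |Real.sin ((n:ℝ) * z)| ≤ n * |Real.sin z| := by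
  induction n with
  | zero => simp
  | succ n ih =>
    push_cast
    rw [add_mul, one_mul, Real.sin_add, add_mul, one_mul]
    refine (abs_add_le _ _).trans ?_
    rw [abs_mul, abs_mul]
    have h1 := Real.abs_cos_le_one z
    have h2 := Real.abs_cos_le_one ((n:ℝ) * z)
    have := abs_nonneg (Real.sin ((n:ℝ)*z))
    have := abs_nonneg (Real.sin z)
    nlinarith

lemma cos_odd (n : ℕ) (z : ℝ) : Real.cos ((2 * (n:ℝ) + 1) * (z - Real.pi/2)) = (-1)^n * Real.sin ((2 * (n:ℝ) + 1) * z) := by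
  rw [show (2 * (n:ℝ) + 1) * (z - Real.pi/2) = (2 * (n:ℝ) + 1) * z - Real.pi / 2 - n * Real.pi by ring,
    Real.cos_sub_nat_mul_pi, Real.cos_sub_pi_div_two]

lemma T1_pos {t : ℝ} (ht : 1 ≤ t) {z : ℝ} (h0 : 0 < z) (h1 : z < Real.pi) : 0 < T2 t (z - Real.pi/2) := by
  have hs : 0 < Real.sin z := Real.sin_pos_of_pos_of_lt_pi h0 h1
  have ht0 : 0 < t := by linarith
  unfold T2
  simp only [cos_odd]
  have hsum : Summable (fun n : ℕ => Real.exp (-Real.pi * ((n:ℝ) + 1/2)^2 * t) * ((-1)^n * Real.sin ((2 * (n:ℝ) + 1) * z))) := by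
    refine Summable.of_norm_bounded (T2_summable ht0) (fun n => ?_)
    rw [norm_mul, norm_mul, norm_pow, norm_neg, norm_one, one_pow, one_mul, Real.norm_of_nonneg (Real.exp_pos _).le]
    have := Real.abs_sin_le_one ((2 * (n:ℝ) + 1) * z)
    have h := Real.exp_pos (-Real.pi * ((n:ℝ) + 1/2)^2 * t)
    rw [Real.norm_eq_abs]
    nlinarith
  rw [hsum.tsum_eq_zero_add]
  set C := Real.exp (-Real.pi * (1/2)^2 * t) * Real.sin z with hC
  have hCpos : 0 < C := mul_pos (Real.exp_pos _) hs
  have hq := q_le ht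
  have hq0 := Real.exp_pos (-Real.pi * t)
  have hb : ∀ n : ℕ, ‖Real.exp (-Real.pi * (((n+1:ℕ):ℝ) + 1/2)^2 * t) * ((-1)^(n+1) * Real.sin ((2 * ((n+1:ℕ):ℝ) + 1) * z))‖
      ≤ (3/4 * C) * (1/4)^n * (1/4) := by
    intro n
    rw [norm_mul, norm_mul, norm_pow, norm_neg, norm_one, one_pow, one_mul, Real.norm_of_nonneg (Real.exp_pos _).le,
      Real.norm_eq_abs]
    have h3 := abs_sin_odd z (2*(n+1)+1)
    rw [abs_of_pos hs] at h3
    push_cast at h3 ⊢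
    have e : Real.exp (-Real.pi * ((n:ℝ) + 1 + 1/2)^2 * t) = Real.exp (-Real.pi * (1/2)^2 * t) * Real.exp (-Real.pi * t) ^ ((n+1)*(n+2)) := by
      rw [← Real.exp_nat_mul, ← Real.exp_add]; congr 1; push_cast; ring
    have e2 : Real.exp (-Real.pi * t) ^ ((n+1)*(n+2)) ≤ (1/16)^(n+1) := by
      calc _ ≤ Real.exp (-Real.pi * t) ^ (n+1) := pow_le_pow_of_le_one hq0.le (by linarith) (by nlinarith)
        _ ≤ _ := by gcongr
    have e3 : (2 * ((n:ℝ)+1) + 1) ≤ 3 * 4^n := by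
      have : ∀ n : ℕ, (2 * ((n:ℝ)+1) + 1) ≤ 3 * 4^n := by
        intro n
        induction n with
        | zero => norm_num
        | succ k ih => push_cast; rw [pow_succ]; have : (0:ℝ) ≤ k := k.cast_nonneg; nlinarith
      exact this n
    rw [e]
    calc _ ≤ (Real.exp (-Real.pi * (1/2)^2 * t) * (1/16)^(n+1)) * ((3 * 4^n) * Real.sin z) := by
          apply mul_le_mul _ _ (abs_nonneg _) (by positivity)
          · gcongr
          · refine h3.trans ?_
            gcongr
      _ = C * (3/16) * ((1/16)^n * 4^n) := by rw [hC]; ring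
      _ = _ := by rw [← mul_pow]; norm_num; ring
  have hg : HasSum (fun n : ℕ => (3/4 * C) * (1/4)^n * (1/4)) ((3/4 * C) * (4/3) * (1/4)) := by
    have := (hasSum_geometric_of_lt_one (r := (1/4:ℝ)) (by norm_num) (by norm_num))
    have h := (this.mul_left (3/4 * C)).mul_right (1/4)
    rw [show ((1:ℝ) - 1/4)⁻¹ = 4/3 by norm_num] at h
    exact h
  have := tsum_of_norm_bounded hg hb
  rw [Real.norm_eq_abs, abs_le] at this
  have h4 : Real.exp (-Real.pi * (((0:ℕ):ℝ) + 1/2)^2 * t) * ((-1)^0 * Real.sin ((2 * ((0:ℕ):ℝ) + 1) * z)) = C := by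
    rw [hC]; norm_num
  rw [h4]
  linarith [this.1]

lemma core_alg {a b A B t1 t2 t3 t4 P Q R : ℝ} (p1 : 0 < t1) (p2 : 0 < P) (p3 : 0 < Q) (p4 : 0 < R)
    (p5 : 0 < t4) (hle : P ≤ R) (i1 : t1 ^ 2 = -B * a + A * b) (i2 : t2 ^ 2 = B * a + A * b)
    (i3 : t3 ^ 2 = A * a + B * b) (i4 : t4 ^ 2 = A * a + -B * b) (j2 : P ^ 2 = b * a + a * b)
    (j3 : Q ^ 2 = a * a + b * b) (j4 : R ^ 2 = a * a + -b * b) :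
    0 < 4 * (R / Q * (t3 / t4))^2 * (1 + R / P * (t2 / t4)) -
      (Q / P * (t1 / t4))^2 * (1 - R / P * (t2 / t4)) := by
  set s := Q / P * (t1 / t4) with hs
  set c := R / P * (t2 / t4) with hc
  set d := R / Q * (t3 / t4) with hd
  have spos : 0 < s := by positivity
  have id1 : s^2 + c^2 = 1 := by
    rw [hs, hc]
    have : Q^2 * t1^2 + R^2 * t2^2 = P^2 * t4^2 := by rw [i1, i2, i4, j2, j3, j4]; ring
    field_simp
    linarith
  have id2 : d^2 * Q^4 + P^4 * s^2 = Q^4 := by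
    rw [hs, hd]
    have : R^2 * t3^2 + P^2 * t1^2 = Q^2 * t4^2 := by rw [i1, i3, i4, j2, j3, j4]; ring
    field_simp
    linear_combination this
  have id3 : Q^4 = P^4 + R^4 := by
    have e : ∀ x : ℝ, x^4 = (x^2)^2 := fun x => by ring
    rw [e Q, e P, e R, j2, j3, j4]; ring
  have id4 : 2 * P^4 ≤ Q^4 := by
    have : P^4 ≤ R^4 := by gcongr
    linarith
  have hQ : 0 < Q^4 := by positivity
  have hd2 : 1 - s^2/2 ≤ d^2 := by
    have : (1 - s^2/2) * Q^4 ≤ d^2 * Q^4 := by nlinarith [sq_nonneg s]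
    exact le_of_mul_le_mul_right this hQ
  have hc1 : 0 < 1 + c := by nlinarith
  have : 4 * d^2 * (1+c) - s^2 * (1-c) = (1+c) * (4 * d^2 - (1-c)^2) := by
    rw [show s^2 = 1 - c^2 by linarith]; ring
  rw [this]
  apply mul_pos hc1
  nlinarith

/-- Core inequality for theta quotients. -/
lemma core {t : ℝ} (ht : 1 ≤ t) {z : ℝ} (h0 : 0 < z) (h1 : z < Real.pi) :
    0 < 4 * (T3 t (Real.pi/2) / T3 t 0 * (T3 t z / T3 t (z + Real.pi/2)))^2 *
      (1 + T3 t (Real.pi/2) / T2 t 0 * (T2 t z / T3 t (z + Real.pi/2))) -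
      (T3 t 0 / T2 t 0 * (T2 t (z - Real.pi/2) / T3 t (z + Real.pi/2)))^2 *
      (1 - T3 t (Real.pi/2) / T2 t 0 * (T2 t z / T3 t (z + Real.pi/2))) := by
  have ht0 : 0 < t := by linarith
  have p1 := T1_pos ht h0 h1
  have p2 := T2_pos ht0
  have p3 := T3_pos ht 0
  have p4 := T3_pos ht (Real.pi/2)
  have p5 := T3_pos ht (z + Real.pi/2)
  have hle := T2_le_T4 ht
  have i1 := T2_sq ht0 (z - Real.pi/2)
  have i2 := T2_sq ht0 z
  have i3 := T3_sq ht0 z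
  have i4 := T3_sq ht0 (z + Real.pi/2)
  have j2 := T2_sq ht0 0
  have j3 := T3_sq ht0 0
  have j4 := T3_sq ht0 (Real.pi/2)
  have sh2 := T2_shift (2*t) (2*z)
  have sh3 := T3_shift (2*t) (2*z)
  have sh2' := T2_shift (2*t) (2*(z+Real.pi/2))
  have sh3' := T3_shift (2*t) (2*(z+Real.pi/2))
  have sh2'' := T2_shift (2*t) (2*(Real.pi/2))
  have sh3'' := T3_shift (2*t) (2*(Real.pi/2))
  rw [show 2 * z - Real.pi = 2 * (z - Real.pi/2) by ring] at sh2 sh3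
  rw [show 2 * (z+Real.pi/2) - Real.pi = 2 * z by ring] at sh2' sh3'
  rw [show 2 * (Real.pi/2) - Real.pi = 0 by ring] at sh2'' sh3''
  rw [mul_zero] at j2 j3
  rw [sh2, sh3] at i1
  rw [← sh3', show T2 (2*t) (2*(z+Real.pi/2)) = - T2 (2*t) (2*z) by linarith] at i4
  rw [← sh3'', show T2 (2*t) (2*(Real.pi/2)) = - T2 (2*t) 0 by linarith] at j4
  exact core_alg p1 p2 p3 p4 p5 hle i1 i2 i3 i4 j2 j3 j4

lemma q_cpow (t y : ℝ) : ((Real.exp (-Real.pi * t) : ℝ) : ℂ) ^ (y : ℂ) = ((Real.exp (-Real.pi * y * t) : ℝ) : ℂ) := by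
  rw [← Complex.ofReal_cpow (Real.exp_pos _).le, ← Real.exp_mul]
  congr 2; ring

lemma theta2_real (t z : ℝ) : theta2 (z : ℂ) ((Real.exp (-Real.pi * t) : ℝ) : ℂ) = (T2 t z : ℂ) := by
  unfold theta2 T2
  rw [Complex.ofReal_mul, Complex.ofReal_tsum]
  congr 2; ext n
  have := q_cpow t (((n:ℝ) + 1/2)^2)
  push_cast at this ⊢
  rw [this]

lemma theta1_real (t z : ℝ) : theta1 (z : ℂ) ((Real.exp (-Real.pi * t) : ℝ) : ℂ) = (T2 t (z - Real.pi/2) : ℂ) := by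
  unfold theta1 T2
  rw [Complex.ofReal_mul, Complex.ofReal_tsum]
  congr 2; ext n
  have := q_cpow t (((n:ℝ) + 1/2)^2)
  rw [cos_odd]
  push_cast at this ⊢
  rw [this]; ring

lemma theta3_real (t z : ℝ) : theta3 (z : ℂ) ((Real.exp (-Real.pi * t) : ℝ) : ℂ) = (T3 t z : ℂ) := by
  unfold theta3 T3
  rw [Complex.ofReal_add, Complex.ofReal_mul, Complex.ofReal_tsum]
  congr 3; ext n
  rw [exp_int]
  push_cast
  rfl

lemma theta4_real (t z : ℝ) : theta4 (z : ℂ) ((Real.exp (-Real.pi * t) : ℝ) : ℂ) = (T3 t (z + Real.pi/2) : ℂ) := by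
  unfold theta4 T3
  rw [Complex.ofReal_add, Complex.ofReal_mul, Complex.ofReal_tsum]
  congr 3; ext n
  rw [exp_int, cos_alt]
  push_cast
  ring

def kint (m t : ℝ) : ℝ := 1 / ((1 - t^2) * (1 - m * t^2)) ^ ((1:ℝ)/2)

lemma ellK_real {m : ℝ} (hm : m ≤ 1) : ellK (m : ℂ) = ((∫ t in (0:ℝ)..1, kint m t : ℝ) : ℂ) := by
  unfold ellK
  rw [← intervalIntegral.integral_ofReal]
  apply intervalIntegral.integral_congr
  intro t ht
  rw [Set.uIcc_of_le zero_le_one] at ht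
  have h1 : t^2 ≤ 1 := by nlinarith [ht.1, ht.2]
  have h2 : 0 ≤ (1 - t^2) * (1 - m * t^2) := by
    apply mul_nonneg
    · linarith
    · nlinarith [sq_nonneg t]
  simp only [kint]
  push_cast
  rw [show ((1:ℂ)/2) = (((1:ℝ)/2 : ℝ) : ℂ) by push_cast; rfl, Complex.ofReal_cpow h2]
  push_cast
  rfl

lemma kint_mono {m m' : ℝ} (h : m ≤ m') (hm' : m' < 1) {t : ℝ} (ht : t ∈ Set.Ioo (0:ℝ) 1) :
    kint m t ≤ kint m' t := by
  have h1 : t^2 < 1 := by nlinarith [ht.1, ht.2]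
  have h2 : 0 < 1 - m' * t^2 := by nlinarith [sq_nonneg t]
  have h3 : 0 < 1 - t^2 := by linarith
  unfold kint
  apply one_div_le_one_div_of_le
  · positivity
  · apply Real.rpow_le_rpow (by positivity) _ (by norm_num)
    apply mul_le_mul_of_nonneg_left _ h3.le
    nlinarith [sq_nonneg t]

lemma kint_integrable {m : ℝ} (h0 : 0 ≤ m) (hm : m < 1) : IntervalIntegrable (kint m) MeasureTheory.volume 0 1 := by
  have hg : IntervalIntegrable (fun t : ℝ => (1 - m) ^ (-(1/2) : ℝ) * (1 - t) ^ (-(1/2) : ℝ)) MeasureTheory.volume 0 1 := by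
    apply IntervalIntegrable.const_mul
    have := (intervalIntegral.intervalIntegrable_rpow' (a := 0) (b := 1) (r := (-(1/2):ℝ)) (by norm_num)).comp_sub_left 1
    simpa using this.symm
  have hmeas : Measurable (kint m) := by
    unfold kint
    fun_prop
  rw [intervalIntegrable_iff, Set.uIoc_of_le zero_le_one, integrableOn_Ioc_iff_integrableOn_Ioo] at hg ⊢
  refine hg.mono' hmeas.aestronglyMeasurable ?_
  refine (MeasureTheory.ae_restrict_iff' measurableSet_Ioo).2 (Filter.Eventually.of_forall ?_)
  intro t ht
  have ht2 : t^2 < 1 := by nlinarith [ht.1, ht.2]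
  have h1 : 0 < 1 - m := by linarith
  have h2 : 0 < 1 - t := by linarith [ht.2]
  have h3 : 1 - m ≤ 1 - m * t^2 := by nlinarith
  have h4 : 1 - t ≤ 1 - t^2 := by nlinarith [ht.1, ht.2]
  have h5 : 0 ≤ kint m t := by
    unfold kint
    have : 0 ≤ (1 - t^2) * (1 - m * t^2) := mul_nonneg (by linarith) (by linarith)
    positivity
  rw [Real.norm_of_nonneg h5, ← Real.mul_rpow h1.le h2.le, Real.rpow_neg (by positivity), ← one_div]
  unfold kint
  apply one_div_le_one_div_of_le (by positivity)
  apply Real.rpow_le_rpow (by positivity) _ (by norm_num)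
  rw [mul_comm]
  apply mul_le_mul h4 h3 h1.le (by linarith)

lemma ellK_one : ellK 1 = 0 := by
  have h := ellK_real (m := 1) le_rfl
  rw [Complex.ofReal_one] at h
  rw [h, intervalIntegral.integral_undef, Complex.ofReal_zero]
  apply not_intervalIntegrable_of_sub_inv_isBigO_punctured (c := 1) _ (by norm_num) (by simp)
  apply Asymptotics.IsBigO.of_bound 3
  have : Set.Ioo (0:ℝ) 2 ∈ nhdsWithin (1:ℝ) {1}ᶜ := mem_nhdsWithin_of_mem_nhds (Ioo_mem_nhds (by norm_num) (by norm_num))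
  filter_upwards [this, self_mem_nhdsWithin] with x hx hx1
  have hne : x - 1 ≠ 0 := sub_ne_zero.2 hx1
  have e : kint 1 x = 1 / |1 - x^2| := by
    unfold kint
    rw [one_mul, ← Real.sqrt_eq_rpow, Real.sqrt_mul_self_eq_abs]
  have h2 : |1 - x^2| = |x - 1| * (1 + x) := by
    rw [show 1 - x^2 = -((x-1) * (1+x)) by ring, abs_neg, abs_mul, abs_of_pos (show 0 < 1 + x by linarith [hx.1])]
  have hp : 0 < |x - 1| := abs_pos.2 hne
  have hp2 : 0 < 1 + x := by linarith [hx.1]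
  rw [e, h2, Real.norm_eq_abs, Real.norm_eq_abs, abs_inv, abs_of_pos (show 0 < 1 / (|x - 1| * (1 + x)) by positivity)]
  rw [inv_eq_one_div, mul_one_div, div_le_div_iff₀ hp (by positivity)]
  nlinarith [hx.2]

lemma theta_one_aux (g : ℕ → ℂ) (hg : ∀ n, ‖g n‖ = 1) (z : ℝ) :
    ∑' n : ℕ, g n * Complex.cos (2 * ((n : ℂ) + 1) * z) = 0 := by
  apply tsum_eq_zero_of_not_summable
  intro hs
  have h1 := hs.tendsto_atTop_zero.norm
  have e : ∀ n : ℕ, ‖g n * Complex.cos (2 * ((n : ℂ) + 1) * z)‖ = |Real.cos (2 * ((n:ℝ)+1) * z)| := by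
    intro n
    rw [norm_mul, hg, one_mul, show (2 * ((n : ℂ) + 1) * z) = ((2 * ((n:ℝ)+1) * z : ℝ) : ℂ) by push_cast; ring,
      ← Complex.ofReal_cos, Complex.norm_real, Real.norm_eq_abs]
  simp only [e, norm_zero] at h1
  have h2 : Filter.Tendsto (fun n : ℕ => |Real.cos (2 * (((2*n+1 : ℕ):ℝ)+1) * z)|) Filter.atTop (nhds 0) :=
    h1.comp (Filter.tendsto_atTop_mono (fun n => by dsimp; omega) Filter.tendsto_id)
  have h3 : Filter.Tendsto (fun n : ℕ => 2 * |Real.cos (2 * ((n:ℝ)+1) * z)|^2 - 1) Filter.atTop (nhds (2 * 0^2 - 1)) :=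
    ((h1.pow 2).const_mul 2).sub_const 1
  have h4 : Filter.Tendsto (fun n : ℕ => |2 * |Real.cos (2 * ((n:ℝ)+1) * z)|^2 - 1|) Filter.atTop (nhds |2 * 0^2 - 1|) := h3.abs
  have h5 : (fun n : ℕ => |2 * |Real.cos (2 * ((n:ℝ)+1) * z)|^2 - 1|) = (fun n : ℕ => |Real.cos (2 * (((2*n+1 : ℕ):ℝ)+1) * z)|) := by
    ext n
    rw [sq_abs, ← Real.cos_two_mul]
    congr 2; push_cast; ring
  rw [h5] at h4
  have := tendsto_nhds_unique h2 h4
  norm_num at this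

lemma theta3_one (z : ℝ) : theta3 (z:ℂ) 1 = 1 := by
  unfold theta3
  rw [theta_one_aux (fun n => (1:ℂ)^((n+1)^2)) (by simp) z]; simp

lemma theta4_one (z : ℝ) : theta4 (z:ℂ) 1 = 1 := by
  unfold theta4
  rw [theta_one_aux (fun n => (-1:ℂ)^(n+1) * (1:ℂ)^((n+1)^2)) (by simp) z]; simp

lemma theta2_one : theta2 0 1 = 0 := by
  unfold theta2
  rw [tsum_eq_zero_of_not_summable, mul_zero]
  intro hs
  have := hs.tendsto_atTop_zero
  simp at this

/-- For real parameter `m ∈ [0,1/2]` and `x ∈ (0, 2K(m))`,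
`4 dn²(x|m)(1 + cn(x|m)) − sn²(x|m)(1 − cn(x|m)) > 0`. -/
theorem aux_ineq (m : ℝ) (hm : m ∈ Set.Icc (0 : ℝ) (1 / 2))
    (x : ℝ) (hx : x ∈ Set.Ioo (0 : ℝ) (2 * KR m)) :
    0 < 4 * (dnR x m) ^ 2 * (1 + cnR x m) - (snR x m) ^ 2 * (1 - cnR x m) := by
  obtain ⟨hm0, hm1⟩ := hm
  obtain ⟨hx0, hx1⟩ := hx
  set k : ℝ := ∫ t in (0:ℝ)..1, kint m t with hk
  have hK : ellK (m : ℂ) = (k : ℂ) := ellK_real (by linarith)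
  have hKR : KR m = k := by rw [KR, hK, Complex.ofReal_re]
  rw [hKR] at hx1
  have kpos : 0 < k := by linarith
  set z : ℝ := Real.pi * x / (2 * k) with hz
  have hzC : (Real.pi : ℂ) * (x : ℂ) / (2 * ellK (m:ℂ)) = (z : ℂ) := by
    rw [hK, hz]; push_cast; rfl
  rcases hm0.eq_or_lt with h | hmpos
  · have hn : nome (m : ℂ) = 1 := by
      unfold nome
      rw [← h, Complex.ofReal_zero, sub_zero, ellK_one]; simp
    have hs : snR x m = 0 := by
      unfold snR sn
      rw [hn, theta2_one]; simp
    have hc : cnR x m = 0 := by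
      unfold cnR cn
      rw [hn, theta2_one]; simp
    have hd : dnR x m = 1 := by
      unfold dnR dn
      have a3 := theta3_one 0
      have a4 := theta4_one 0
      rw [Complex.ofReal_zero] at a3 a4
      rw [hn, hzC, theta3_one, theta4_one, a3, a4]; simp
    rw [hs, hc, hd]; norm_num
  · set k' : ℝ := ∫ t in (0:ℝ)..1, kint (1 - m) t with hk'
    have hK' : ellK (1 - (m : ℂ)) = (k' : ℂ) := by
      rw [← Complex.ofReal_one, ← Complex.ofReal_sub]
      exact ellK_real (by linarith)
    have hkk : k ≤ k' :=
      intervalIntegral.integral_mono_on_of_le_Ioo zero_le_one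
        (kint_integrable hm0 (by linarith)) (kint_integrable (by linarith) (by linarith))
        (fun t ht => kint_mono (by linarith) (by linarith) ht)
    set t : ℝ := k' / k with ht
    have ht1 : 1 ≤ t := by rw [ht, le_div_iff₀ kpos]; linarith
    have hn : nome (m : ℂ) = ((Real.exp (-Real.pi * t) : ℝ) : ℂ) := by
      unfold nome
      rw [hK, hK', ht]; push_cast; congr 1; ring
    have z0 : 0 < z := by rw [hz]; have := Real.pi_pos; positivity
    have z1 : z < Real.pi := by
      rw [hz, div_lt_iff₀ (by linarith)]
      exact mul_lt_mul_of_pos_left hx1 Real.pi_pos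
    have b2 := theta2_real t 0
    have b3 := theta3_real t 0
    have b4 := theta4_real t 0
    rw [Complex.ofReal_zero] at b2 b3 b4
    rw [zero_add] at b4
    have hs : snR x m = T3 t 0 / T2 t 0 * (T2 t (z - Real.pi/2) / T3 t (z + Real.pi/2)) := by
      unfold snR sn
      rw [hzC, hn, b2, b3, theta1_real, theta4_real]
      norm_cast
    have hc : cnR x m = T3 t (Real.pi/2) / T2 t 0 * (T2 t z / T3 t (z + Real.pi/2)) := by
      unfold cnR cn
      rw [hzC, hn, b2, b4, theta2_real, theta4_real]
      norm_cast
    have hd : dnR x m = T3 t (Real.pi/2) / T3 t 0 * (T3 t z / T3 t (z + Real.pi/2)) := by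
      unfold dnR dn
      rw [hzC, hn, b3, b4, theta3_real, theta4_real]
      norm_cast
    rw [hs, hc, hd]
    exact core ht1 z0 z1
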